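/- Let c > 0 and let I = (I₁,…,I_k) be a partition of [n] into consecutive intervals with |I_{j+1}| = (1+c)·|I_j| for all 1 ≤ j ≤ k−1. Let D be a distribution over [n] that is a k-histogram on I and is ε-close to monotone. Then for every 1 ≤ j ≤ k−1, D(I_{j+1}) ≤ (1+c)·D(I_j) + ε·(2+c). -/

import Mathlib

open Finset

/-- A probability distribution over a finite type. -/
def IsDist {Ω : Type*} [Fintype Ω] (D : Ω → ℝ) : Prop :=
  (∀ x, 0 ≤ D x) ∧ ∑ x, D x = 1

/-- Total variation distance. -/
noncomputable def tv {Ω : Type*} [Fintype Ω] (D₁ D₂ : Ω → ℝ) : ℝ :=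
  (1 / 2) * ∑ x, |D₁ x - D₂ x|

/-- The total mass `D(I_j)` of the `j`-th interval (fiber of `idx`). -/
noncomputable def intervalMass {n k : ℕ} (idx : Fin n → Fin k) (D : Fin n → ℝ) (j : Fin k) : ℝ :=
  ∑ y ∈ univ.filter (fun y => idx y = j), D y

theorem tv_comm {Ω : Type*} [Fintype Ω] (D₁ D₂ : Ω → ℝ) : tv D₁ D₂ = tv D₂ D₁ := by
  simp only [tv, abs_sub_comm]

/-- The masses that two distributions give to an event differ by at most their total variation
distance. -/
theorem sum_le_sum_add_tv {Ω : Type*} [Fintype Ω] {D₁ D₂ : Ω → ℝ}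
    (h₁ : IsDist D₁) (h₂ : IsDist D₂) (S : Finset Ω) :
    ∑ x ∈ S, D₁ x ≤ ∑ x ∈ S, D₂ x + tv D₁ D₂ := by
  classical
  have hS : ∑ x ∈ S, (D₁ x - D₂ x) ≤ ∑ x ∈ S, |D₁ x - D₂ x| :=
    sum_le_sum fun x _ => le_abs_self _
  have hSc : -∑ x ∈ Sᶜ, |D₁ x - D₂ x| ≤ ∑ x ∈ Sᶜ, (D₁ x - D₂ x) := by
    rw [← sum_neg_distrib]
    exact sum_le_sum fun x _ => neg_abs_le _
  have habs := sum_add_sum_compl S fun x => |D₁ x - D₂ x|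
  have hdiff := sum_add_sum_compl S fun x => D₁ x - D₂ x
  rw [sum_sub_distrib D₁ D₂ (s := univ), h₁.2, h₂.2] at hdiff
  rw [sum_sub_distrib] at hS hdiff
  unfold tv
  linarith

/-- If every value of `f` on `B` is at most every value of `f` on `A`, then the average of `f`
over `B` is at most its average over `A`. -/
theorem card_mul_sum_le_card_mul_sum {α : Type*} {f : α → ℝ} {A B : Finset α}
    (h : ∀ a ∈ A, ∀ b ∈ B, f b ≤ f a) :
    (#A : ℝ) * ∑ b ∈ B, f b ≤ (#B : ℝ) * ∑ a ∈ A, f a := by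
  calc (#A : ℝ) * ∑ b ∈ B, f b = ∑ a ∈ A, ∑ b ∈ B, f b := by simp
    _ ≤ ∑ a ∈ A, ∑ b ∈ B, f a :=
      sum_le_sum fun a ha => sum_le_sum fun b hb => h a ha b hb
    _ = (#B : ℝ) * ∑ a ∈ A, f a := by simp [mul_sum]

/-- Let `c > 0` and `I = (I₁,…,I_k)` a partition of `[n]` into consecutive intervals
(encoded by a monotone surjective `idx : Fin n → Fin k`, whose fibers are the intervals)
with `|I_{j+1}| = (1+c)·|I_j|` for all `j`.  If `D` is a `k`-histogram on `I` (constant on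
each interval) and `ε`-close to monotone (non-increasing, i.e. `Antitone`), then for every
`j` with `j+1 < k`: `D(I_{j+1}) ≤ (1+c)·D(I_j) + ε·(2+c)`. -/
theorem stmt_2 {n k : ℕ} (c ε : ℝ) (hc : 0 < c)
    (idx : Fin n → Fin k) (hmono : Monotone idx) (hsurj : Function.Surjective idx)
    (hsize : ∀ (j : Fin k) (hj : j.val + 1 < k),
      ((univ.filter (fun y => idx y = (⟨j.val + 1, hj⟩ : Fin k))).card : ℝ) =
        (1 + c) * ((univ.filter (fun y => idx y = j)).card : ℝ))
    (D : Fin n → ℝ) (hD : IsDist D)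
    (hhist : ∀ y y', idx y = idx y' → D y = D y')
    (hclose : ∃ M : Fin n → ℝ, IsDist M ∧ Antitone M ∧ tv D M ≤ ε) :
    ∀ (j : Fin k) (hj : j.val + 1 < k),
      intervalMass idx D ⟨j.val + 1, hj⟩ ≤ (1 + c) * intervalMass idx D j + ε * (2 + c) := by
  obtain ⟨M, hM, hanti, htv⟩ := hclose
  intro j hj
  have hcard : (0 : ℝ) < #(univ.filter fun y => idx y = j) := by
    obtain ⟨y, hy⟩ := hsurj j
    exact_mod_cast card_pos.mpr ⟨y, by simpa using hy⟩
  have hratio : intervalMass idx M ⟨j.val + 1, hj⟩ ≤ (1 + c) * intervalMass idx M j := by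
    have h := card_mul_sum_le_card_mul_sum (f := M) (A := univ.filter fun y => idx y = j)
      (B := univ.filter fun y => idx y = ⟨j.val + 1, hj⟩) fun a ha b hb => by
        simp only [mem_filter, mem_univ, true_and] at ha hb
        refine hanti (hmono.reflect_lt ?_).le
        rw [ha, hb, Fin.lt_def]
        exact Nat.lt_succ_self _
    rw [hsize j hj, mul_right_comm, mul_comm] at h
    exact le_of_mul_le_mul_right h hcard
  have hnext : intervalMass idx D ⟨j.val + 1, hj⟩ ≤ intervalMass idx M ⟨j.val + 1, hj⟩ + ε :=
    (sum_le_sum_add_tv hD hM _).trans (by unfold intervalMass; gcongr)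
  have hcur : intervalMass idx M j ≤ intervalMass idx D j + ε :=
    (sum_le_sum_add_tv hM hD _).trans (by rw [tv_comm]; unfold intervalMass; gcongr)
  have hcur' := mul_le_mul_of_nonneg_left hcur (by linarith : 0 ≤ 1 + c)
  linarith
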